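/- Let S₁, …, Sₙ ⊂ ℝ^d be independent integral simplices and let a₁, …, aₙ be positive integers. Then the Minkowski sum ∑_{j=1}^n a_j·S_j admits a triangulation into integral simplices S' satisfying L(S') = L(S₁) + ⋯ + L(Sₙ). In particular, for every integral simplex T ⊂ ℝ^d and every positive integer c, the dilated simplex c·T admits a triangulation into integral simplices S' with L(S') = L(T), so each simplex of the triangulation has the same index as T. -/

import Mathlib

open Pointwise

/-- A point of `ℝ^d` with integer coordinates. -/
def IsLatticePt {d : ℕ} (x : Fin d → ℝ) : Prop := ∀ i, ∃ z : ℤ, x i = (z : ℝ)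

/-- The subgroup `ℤ^d` of integral points of `ℝ^d`. -/
def intLattice (d : ℕ) : AddSubgroup (Fin d → ℝ) where
  carrier := {x | IsLatticePt x}
  zero_mem' := fun i => ⟨0, by simp⟩
  add_mem' := by
    rintro a b ha hb i
    obtain ⟨z, hz⟩ := ha i
    obtain ⟨w, hw⟩ := hb i
    exact ⟨z + w, by simp [hz, hw]⟩
  neg_mem' := by
    rintro a ha i
    obtain ⟨z, hz⟩ := ha i
    exact ⟨-z, by simp [hz]⟩

/-- A polytope: the convex hull of a nonempty finite set of points. -/
def IsPolytope {d : ℕ} (P : Set (Fin d → ℝ)) : Prop :=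
  ∃ V : Finset (Fin d → ℝ), V.Nonempty ∧ P = convexHull ℝ (V : Set (Fin d → ℝ))

/-- An integral polytope: the convex hull of a nonempty finite set of integral points. -/
def IsIntegralPolytope {d : ℕ} (P : Set (Fin d → ℝ)) : Prop :=
  ∃ V : Finset (Fin d → ℝ), V.Nonempty ∧ (∀ v ∈ V, IsLatticePt v) ∧
    P = convexHull ℝ (V : Set (Fin d → ℝ))

/-- A simplex: the convex hull of a nonempty affinely independent finite set. -/
def IsSimplex {d : ℕ} (P : Set (Fin d → ℝ)) : Prop :=
  ∃ V : Finset (Fin d → ℝ), V.Nonempty ∧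
    AffineIndependent ℝ (Subtype.val : ↥(V : Set (Fin d → ℝ)) → (Fin d → ℝ)) ∧
    P = convexHull ℝ (V : Set (Fin d → ℝ))

/-- An integral simplex. -/
def IsIntegralSimplex {d : ℕ} (P : Set (Fin d → ℝ)) : Prop :=
  ∃ V : Finset (Fin d → ℝ), V.Nonempty ∧ (∀ v ∈ V, IsLatticePt v) ∧
    AffineIndependent ℝ (Subtype.val : ↥(V : Set (Fin d → ℝ)) → (Fin d → ℝ)) ∧
    P = convexHull ℝ (V : Set (Fin d → ℝ))

/-- The set of differences of vertices (= extreme points) of a polytope. -/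
def vertexDiffs {d : ℕ} (P : Set (Fin d → ℝ)) : Set (Fin d → ℝ) :=
  {w | ∃ u ∈ P.extremePoints ℝ, ∃ v ∈ P.extremePoints ℝ, w = u - v}

/-- `L(P)`: the subgroup of `ℤ^d` generated by differences of vertices of `P`. -/
def latL {d : ℕ} (P : Set (Fin d → ℝ)) : AddSubgroup (Fin d → ℝ) :=
  AddSubgroup.closure (vertexDiffs P)

/-- `N(P)`: the intersection of the real span of `L(P)` with `ℤ^d`. -/
def latN {d : ℕ} (P : Set (Fin d → ℝ)) : AddSubgroup (Fin d → ℝ) :=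
  (Submodule.span ℝ (vertexDiffs P)).toAddSubgroup ⊓ intLattice d

/-- The (normalized) index of an integral polytope: the group index `[N(P) : L(P)]`. -/
noncomputable def polyIndex {d : ℕ} (P : Set (Fin d → ℝ)) : ℕ :=
  ((latL P).addSubgroupOf (latN P)).index

/-- A unimodular simplex: an integral simplex of index 1. -/
def IsUnimodularSimplex {d : ℕ} (P : Set (Fin d → ℝ)) : Prop :=
  IsIntegralSimplex P ∧ polyIndex P = 1

/-- `F` is a face of `P`: the (nonempty) set of maximizers on `P` of a linear functional. -/
def IsFaceOf {d : ℕ} (F P : Set (Fin d → ℝ)) : Prop :=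
  F.Nonempty ∧ ∃ φ : (Fin d → ℝ) →ₗ[ℝ] ℝ, F = {x ∈ P | ∀ y ∈ P, φ y ≤ φ x}

/-- A triangulation of `Q`: a finite, face-closed collection of simplices with union `Q`,
any two of which meet in a (possibly empty) common face. -/
def IsTriangulation {d : ℕ} (T : Set (Set (Fin d → ℝ))) (Q : Set (Fin d → ℝ)) : Prop :=
  T.Finite ∧ (∀ S ∈ T, IsSimplex S) ∧ ⋃₀ T = Q ∧
    (∀ S ∈ T, ∀ F, IsFaceOf F S → F ∈ T) ∧
    ∀ S₁ ∈ T, ∀ S₂ ∈ T, S₁ ∩ S₂ = ∅ ∨ (IsFaceOf (S₁ ∩ S₂) S₁ ∧ IsFaceOf (S₁ ∩ S₂) S₂)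

/-- A unimodular triangulation: all of its simplices are unimodular. -/
def IsUnimodularTriangulation {d : ℕ} (T : Set (Set (Fin d → ℝ))) (Q : Set (Fin d → ℝ)) : Prop :=
  IsTriangulation T Q ∧ ∀ S ∈ T, IsUnimodularSimplex S

section Faces

variable {d : ℕ}

/-- The face of `conv s` on which a linear functional is maximal is spanned by the points of `s`
maximizing the functional. -/
theorem maximizers_convexHull (s : Finset (Fin d → ℝ)) (φ : (Fin d → ℝ) →ₗ[ℝ] ℝ) :
    {x ∈ convexHull ℝ (s : Set (Fin d → ℝ)) |
        ∀ y ∈ convexHull ℝ (s : Set (Fin d → ℝ)), φ y ≤ φ x} =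
      convexHull ℝ {v | v ∈ s ∧ ∀ w ∈ s, φ w ≤ φ v} := by
  classical
  have hle (M : ℝ) (hM : ∀ w ∈ s, φ w ≤ M) :
      ∀ y ∈ convexHull ℝ (s : Set (Fin d → ℝ)), φ y ≤ M := by
    intro y hy
    have : convexHull ℝ (s : Set (Fin d → ℝ)) ⊆ {y | φ y ≤ M} :=
      convexHull_min (fun w hw => hM w hw) (convex_halfSpace_le φ.isLinear M)
    exact this hy
  apply Set.Subset.antisymm
  · rintro x ⟨hx, hmax⟩
    obtain ⟨w, hw0, hw1, hwx⟩ := Finset.mem_convexHull'.1 hx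
    have hsub (v) (hv : v ∈ s) : φ v ≤ φ x := hmax v (subset_convexHull ℝ _ hv)
    have hsum : ∑ v ∈ s, w v * (φ x - φ v) = 0 := by
      have : φ x = ∑ v ∈ s, w v * φ v := by
        conv_lhs => rw [← hwx]
        simp
      simp only [mul_sub, Finset.sum_sub_distrib, ← Finset.sum_mul, hw1]
      linarith
    have hzero := (Finset.sum_eq_zero_iff_of_nonneg
      (fun v hv => mul_nonneg (hw0 v hv) (sub_nonneg.2 (hsub v hv)))).1 hsum
    have hset : {v | v ∈ s ∧ ∀ w ∈ s, φ w ≤ φ v} =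
        ((s.filter fun v => ∀ w ∈ s, φ w ≤ φ v : Finset _) : Set (Fin d → ℝ)) := by
      ext v; simp
    have hvanish (v) (hv : v ∈ s) (hv' : v ∉ s.filter fun v => ∀ w ∈ s, φ w ≤ φ v) :
        w v = 0 := by
      rcases mul_eq_zero.1 (hzero v hv) with h | h
      · exact h
      · refine absurd ?_ hv'
        refine Finset.mem_filter.2 ⟨hv, fun u hu => ?_⟩
        linarith [hsub u hu]
    rw [hset, Finset.mem_convexHull']
    refine ⟨w, fun v hv => hw0 v (Finset.mem_filter.1 hv).1, ?_, ?_⟩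
    · rw [← hw1]
      exact Finset.sum_subset (Finset.filter_subset _ _) hvanish
    · rw [← hwx]
      refine Finset.sum_subset (Finset.filter_subset _ _) fun v hv hv' => ?_
      rw [hvanish v hv hv', zero_smul]
  · refine fun x hx => ⟨convexHull_mono (fun v hv => hv.1) hx, hle _ fun w hw => ?_⟩
    have : convexHull ℝ {v | v ∈ s ∧ ∀ w ∈ s, φ w ≤ φ v} ⊆ {y | φ w ≤ φ y} :=
      convexHull_min (fun v hv => hv.2 w hw) (convex_halfSpace_ge φ.isLinear _)
    exact this hx

/-- A nonempty set of vertices of a simplex spans a face. -/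
theorem isFaceOf_convexHull_of_subset {s t : Finset (Fin d → ℝ)}
    (hs : AffineIndependent ℝ (Subtype.val : ↥(s : Set (Fin d → ℝ)) → (Fin d → ℝ)))
    (hts : t ⊆ s) (ht : t.Nonempty) :
    IsFaceOf (convexHull ℝ (t : Set (Fin d → ℝ))) (convexHull ℝ (s : Set (Fin d → ℝ))) := by
  classical
  obtain ⟨B, hsB, hB, hspan⟩ := exists_subset_affineIndependent_affineSpan_eq_top hs
  let b : AffineBasis B ℝ (Fin d → ℝ) := ⟨Subtype.val, hB, by simpa using hspan⟩
  let e : ↥t → B := fun v => ⟨v, hsB (hts v.2)⟩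
  let φ : (Fin d → ℝ) →ₗ[ℝ] ℝ := ∑ v : ↥t, (b.coord (e v)).linear
  let k : ℝ := ∑ v : ↥t, b.coord (e v) 0
  have hφ (u : B) : φ u.1 = (if u.1 ∈ t then 1 else 0) - k := by
    have h1 (v : ↥t) : (b.coord (e v)).linear u.1 =
        (if u = e v then 1 else 0) - b.coord (e v) 0 := by
      have h2 : b.coord (e v) u.1 = if u = e v then 1 else 0 := by
        have := b.coord_apply (e v) u
        simp only [eq_comm (a := e v)] at this
        exact this
      rw [← h2]
      simpa using (b.coord (e v)).linearMap_vsub u.1 0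
    simp only [φ, k, LinearMap.sum_apply, h1, Finset.sum_sub_distrib, sub_left_inj]
    split_ifs with hu
    · rw [Finset.sum_eq_single ⟨u.1, hu⟩]
      · simp [e]
      · intro v _ hv
        rw [if_neg]
        rintro rfl
        exact hv rfl
      · simp
    · refine Finset.sum_eq_zero fun v _ => if_neg ?_
      rintro rfl
      exact hu v.2
  have hφs (u) (hu : u ∈ s) : φ u = (if u ∈ t then 1 else 0) - k := hφ ⟨u, hsB hu⟩
  refine ⟨(convexHull_nonempty_iff).2 ht, φ, ?_⟩
  rw [maximizers_convexHull]
  congr 1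
  obtain ⟨v₀, hv₀⟩ := ht
  ext v
  simp only [Finset.mem_coe, Set.mem_ofPred_eq]
  constructor
  · intro hv
    refine ⟨hts hv, fun w hw => ?_⟩
    rw [hφs w hw, hφs v (hts hv), if_pos hv]
    split_ifs <;> linarith
  · rintro ⟨hv, hmax⟩
    by_contra hvt
    have := hmax v₀ (hts hv₀)
    rw [hφs _ (hts hv₀), hφs v hv, if_pos hv₀, if_neg hvt] at this
    linarith

theorem IsFaceOf.isExtreme {F P : Set (Fin d → ℝ)} (h : IsFaceOf F P) : IsExtreme ℝ P F := by
  obtain ⟨-, φ, rfl⟩ := h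
  refine ⟨fun x hx => hx.1, ?_⟩
  rintro x hx y hy z ⟨hz, hmax⟩ ⟨α, β, hα, hβ, hαβ, rfl⟩
  refine ⟨hx, fun w hw => ?_⟩
  have h1 := hmax w hw
  have h2 := hmax y hy
  simp only [map_add, map_smul, smul_eq_mul] at h1 h2
  obtain rfl : β = 1 - α := by linarith
  have h3 : φ y ≤ φ x := by
    by_contra! hlt
    nlinarith
  nlinarith

theorem AffineIndependent.extremePoints_convexHull {s : Finset (Fin d → ℝ)}
    (hs : AffineIndependent ℝ (Subtype.val : ↥(s : Set (Fin d → ℝ)) → (Fin d → ℝ))) :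
    (convexHull ℝ (s : Set (Fin d → ℝ))).extremePoints ℝ = s := by
  refine Set.Subset.antisymm extremePoints_convexHull_subset fun v hv => ?_
  have h := isFaceOf_convexHull_of_subset hs (Finset.singleton_subset_iff.2 hv)
    (Finset.singleton_nonempty v)
  rw [Finset.coe_singleton, convexHull_singleton] at h
  exact isExtreme_singleton.1 h.isExtreme

open Geometry in
/-- A finite geometric simplicial complex is a triangulation of its underlying space. -/
theorem Geometry.SimplicialComplex.isTriangulation (K : SimplicialComplex ℝ (Fin d → ℝ))
    (hK : K.faces.Finite) :
    IsTriangulation ((fun s : Finset (Fin d → ℝ) => convexHull ℝ (s : Set (Fin d → ℝ))) '' K.faces)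
      K.space := by
  classical
  refine ⟨hK.image _, ?_, ?_, ?_, ?_⟩
  · rintro _ ⟨s, hs, rfl⟩
    exact ⟨s, K.nonempty_of_mem_faces hs, K.indep hs, rfl⟩
  · simp [SimplicialComplex.space, Set.sUnion_image]
  · rintro _ ⟨s, hs, rfl⟩ F ⟨hF, φ, rfl⟩
    rw [maximizers_convexHull] at hF ⊢
    refine ⟨s.filter fun v => ∀ w ∈ s, φ w ≤ φ v,
      K.down_closed hs (Finset.filter_subset _ _) ?_, by simp⟩
    obtain ⟨v, hv⟩ := convexHull_nonempty_iff.1 hF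
    exact ⟨v, Finset.mem_filter.2 hv⟩
  · rintro _ ⟨s, hs, rfl⟩ _ ⟨t, ht, rfl⟩
    have hst := K.convexHull_inter_convexHull hs ht
    rw [← Finset.coe_inter] at hst
    simp only [hst]
    rcases (s ∩ t).eq_empty_or_nonempty with h | h
    · left
      simp [h]
    · exact Or.inr ⟨isFaceOf_convexHull_of_subset (K.indep hs) Finset.inter_subset_left h,
        isFaceOf_convexHull_of_subset (K.indep ht) Finset.inter_subset_right h⟩

end Faces

section Kuhn

variable {I : Type*}

/-- Two lattice points are adjacent in the Kuhn triangulation if they are comparable and their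
coordinates differ by at most one. -/
def KuhnAdj (z w : I → ℤ) : Prop :=
  (z ≤ w ∧ w ≤ z + 1) ∨ (w ≤ z ∧ z ≤ w + 1)

/-- The smallest vertex of a positive combination of pairwise adjacent lattice points is the floor
of the (normalized) combination. -/
theorem exists_min_vertex [Fintype I] {ι : Type*} (U : Finset ι) (c : ι → I → ℤ) (l : ι → ℝ)
    (h0 : ∀ i ∈ U, 0 ≤ l i)
    (hadj : ∀ i ∈ U, ∀ j ∈ U, 0 < l i → 0 < l j → KuhnAdj (c i) (c j))
    (hpos : 0 < ∑ i ∈ U, l i) :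
    ∃ i ∈ U, 0 < l i ∧
      ∀ p, c i p = ⌊(∑ j ∈ U, l j * (c j p : ℝ)) / ∑ j ∈ U, l j⌋ := by
  classical
  obtain ⟨i₁, hi₁, hi₁'⟩ := Finset.exists_lt_of_sum_lt
    (s := U) (f := fun _ => (0 : ℝ)) (g := l) (by simpa using hpos)
  obtain ⟨i, hi⟩ := (U.filter fun i => 0 < l i).exists_minimalFor c
    ⟨i₁, Finset.mem_filter.2 ⟨hi₁, hi₁'⟩⟩
  obtain ⟨hiU, hil⟩ := Finset.mem_filter.1 hi.1
  refine ⟨i, hiU, hil, fun p => ?_⟩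
  have hbd (j) (hj : j ∈ U) (hjl : 0 < l j) : c i p ≤ c j p ∧ c j p ≤ c i p + 1 := by
    have hle : c i ≤ c j := by
      rcases hadj i hiU j hj hil hjl with h | h
      · exact h.1
      · exact hi.2 (Finset.mem_filter.2 ⟨hj, hjl⟩) h.1
    refine ⟨hle p, ?_⟩
    rcases hadj i hiU j hj hil hjl with h | h
    · exact h.2 p
    · have := h.1 p
      linarith
  have hlow (j) (hj : j ∈ U) : l j * (c i p : ℝ) ≤ l j * (c j p : ℝ) := by
    rcases (h0 j hj).eq_or_lt with h | h
    · simp [← h]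
    · exact mul_le_mul_of_nonneg_left (by exact_mod_cast (hbd j hj h).1) h.le
  have hup (j) (hj : j ∈ U) : l j * (c j p : ℝ) ≤ l j * (c i p + 1 : ℝ) := by
    rcases (h0 j hj).eq_or_lt with h | h
    · simp [← h]
    · exact mul_le_mul_of_nonneg_left (by exact_mod_cast (hbd j hj h).2) h.le
  symm
  rw [Int.floor_eq_iff, le_div_iff₀ hpos, div_lt_iff₀ hpos]
  constructor
  · rw [mul_comm, Finset.sum_mul]
    exact Finset.sum_le_sum hlow
  · rw [mul_comm, Finset.sum_mul]
    refine Finset.sum_lt_sum hup ⟨i, hiU, ?_⟩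
    exact mul_lt_mul_of_pos_left (by simp) hil

/-- A point is in at most one way a nonnegative combination of pairwise adjacent lattice points. -/
theorem kuhn_weights_unique [Fintype I] {ι : Type*} (U : Finset ι) (c : ι → I → ℤ)
    (hc : Set.InjOn c U) (l m : ι → ℝ) (hl : ∀ i ∈ U, 0 ≤ l i) (hm : ∀ i ∈ U, 0 ≤ m i)
    (hladj : ∀ i ∈ U, ∀ j ∈ U, 0 < l i → 0 < l j → KuhnAdj (c i) (c j))
    (hmadj : ∀ i ∈ U, ∀ j ∈ U, 0 < m i → 0 < m j → KuhnAdj (c i) (c j))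
    (hsum : ∑ i ∈ U, l i = ∑ i ∈ U, m i)
    (hmom : ∀ p, ∑ i ∈ U, l i * (c i p : ℝ) = ∑ i ∈ U, m i * (c i p : ℝ)) :
    ∀ i ∈ U, l i = m i := by
  classical
  induction hN : (U.filter fun i => 0 < l i).card + (U.filter fun i => 0 < m i).card
    using Nat.strong_induction_on generalizing l m with
  | _ N ih =>
  rcases (Finset.sum_nonneg hl).eq_or_lt with h | hpos
  · intro i hi
    rw [(Finset.sum_eq_zero_iff_of_nonneg hl).1 h.symm i hi,
      (Finset.sum_eq_zero_iff_of_nonneg hm).1 (hsum ▸ h.symm) i hi]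
  obtain ⟨i, hi, hil, hci⟩ := exists_min_vertex U c l hl hladj hpos
  obtain ⟨j, hj, hjm, hcj⟩ := exists_min_vertex U c m hm hmadj (hsum ▸ hpos)
  obtain rfl : i = j := hc hi hj <| funext fun p => by rw [hci, hcj, hmom, hsum]
  set r := min (l i) (m i) with hr
  have hrpos : 0 < r := lt_min hil hjm
  have hrl : r ≤ l i := min_le_left _ _
  have hrm : r ≤ m i := min_le_right _ _
  let l' : ι → ℝ := fun k => l k - if k = i then r else 0
  let m' : ι → ℝ := fun k => m k - if k = i then r else 0
  have hl'le (k) : l' k ≤ l k := by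
    simp only [l']; split_ifs <;> linarith
  have hm'le (k) : m' k ≤ m k := by
    simp only [m']; split_ifs <;> linarith
  have hlsub : (U.filter fun i => 0 < l' i) ⊆ U.filter fun i => 0 < l i :=
    Finset.monotone_filter_right _ fun k _ hk => hk.trans_le (hl'le k)
  have hmsub : (U.filter fun i => 0 < m' i) ⊆ U.filter fun i => 0 < m i :=
    Finset.monotone_filter_right _ fun k _ hk => hk.trans_le (hm'le k)
  have key := ih _ (by
      rw [← hN]
      rcases min_choice (l i) (m i) with h | h
      · refine add_lt_add_of_lt_of_le (Finset.card_lt_card ⟨hlsub, fun hh => ?_⟩)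
          (Finset.card_le_card hmsub)
        have := (Finset.mem_filter.1 (hh (Finset.mem_filter.2 ⟨hi, hil⟩))).2
        simp [l', hr, h] at this
      · refine add_lt_add_of_le_of_lt (Finset.card_le_card hlsub)
          (Finset.card_lt_card ⟨hmsub, fun hh => ?_⟩)
        have := (Finset.mem_filter.1 (hh (Finset.mem_filter.2 ⟨hi, hjm⟩))).2
        simp [m', hr, h] at this) l' m'
    (by
      intro k hk
      simp only [l']
      split_ifs with h
      · subst h; linarith
      · linarith [hl k hk])
    (by
      intro k hk
      simp only [m']
      split_ifs with h
      · subst h; linarith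
      · linarith [hm k hk])
    (fun a ha b hb h1 h2 => hladj a ha b hb (h1.trans_le (hl'le a)) (h2.trans_le (hl'le b)))
    (fun a ha b hb h1 h2 => hmadj a ha b hb (h1.trans_le (hm'le a)) (h2.trans_le (hm'le b)))
    (by simp only [l', m', Finset.sum_sub_distrib, hsum])
    (by
      intro p
      simp only [l', m', sub_mul, Finset.sum_sub_distrib, hmom])
    rfl
  intro k hk
  simpa [l', m'] using key k hk

/-- The vertices of a simplex of the Kuhn triangulation: the coordinates of `z` are increased by
one, in the order given by `σ`. -/
def kuhnChain {m : ℕ} (z : I → ℤ) (σ : Fin m ≃ I) (t : Fin (m + 1)) : I → ℤ :=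
  fun p => z p + if (σ.symm p).castSucc < t then 1 else 0

theorem kuhnAdj_kuhnChain {m : ℕ} (z : I → ℤ) (σ : Fin m ≃ I) (s t : Fin (m + 1)) :
    KuhnAdj (kuhnChain z σ s) (kuhnChain z σ t) := by
  wlog h : s ≤ t generalizing s t
  · exact (this t s (le_of_not_ge h)).symm
  left
  constructor <;> intro p <;> simp only [kuhnChain, Pi.add_apply, Pi.one_apply]
  · split_ifs with h1 h2
    · rfl
    · exact absurd (h1.trans_le h) h2
    · simp
    · rfl
  · split_ifs <;> linarith

theorem sum_range_ite_sub (F : ℕ → ℝ) (i n : ℕ) (h : i + 1 ≤ n) :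
    ∑ t ∈ Finset.range n, (if i < t then F t - F (t + 1) else 0) = F (i + 1) - F n := by
  induction n, h using Nat.le_induction with
  | base =>
    rw [sub_self]
    exact Finset.sum_eq_zero fun t ht => if_neg (by have := Finset.mem_range.1 ht; omega)
  | succ n hn ih =>
    rw [Finset.sum_range_succ, ih, if_pos (by omega)]
    ring

/-- A weakly decreasing tuple in the unit cube is a convex combination of indicators of initial
segments. -/
theorem mem_convexHull_initial_segments {m : ℕ} (g : Fin m → ℝ) (hg : Antitone g)
    (h0 : ∀ i, 0 ≤ g i) (h1 : ∀ i, g i ≤ 1) :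
    g ∈ convexHull ℝ (Set.range fun (t : Fin (m + 1)) (i : Fin m) =>
      if i.castSucc < t then (1 : ℝ) else 0) := by
  let F : ℕ → ℝ := fun t => if t = 0 then 1 else if h : t - 1 < m then g ⟨t - 1, h⟩ else 0
  have hF (t : ℕ) : F (t + 1) ≤ F t := by
    rcases t with _ | t
    · simp only [F]
      split_ifs <;> simp_all
    · simp only [F, Nat.succ_ne_zero, if_false, Nat.add_sub_cancel]
      split_ifs with h h'
      · exact hg (by simp)
      · omega
      · exact h0 _
      · rfl
  have hFs (i : Fin m) : F (i + 1) = g i := by simp [F]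
  have hFm : F (m + 1) = 0 := by simp [F]
  rw [mem_convexHull_iff_exists_fintype]
  refine ⟨Fin (m + 1), inferInstance, fun t => F t - F (t + 1),
    fun t i => if i.castSucc < t then (1 : ℝ) else 0, fun t => sub_nonneg.2 (hF t), ?_,
    fun t => ⟨t, rfl⟩, ?_⟩
  · rw [Fin.sum_univ_eq_sum_range (fun t => F t - F (t + 1)), Finset.sum_range_sub', hFm]
    simp [F]
  · ext i
    have := sum_range_ite_sub F i (m + 1) (by have := i.2; omega)
    rw [hFs, hFm, sub_zero, ← Fin.sum_univ_eq_sum_range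
      (fun t => if (i : ℕ) < t then F t - F (t + 1) else 0)] at this
    rw [← this, Finset.sum_apply]
    refine Finset.sum_congr rfl fun t _ => ?_
    simp [Fin.lt_def]

end Kuhn

section VertexLattice

variable {d : ℕ}

theorem vertexDiffs_convexHull {s : Finset (Fin d → ℝ)}
    (hs : AffineIndependent ℝ (Subtype.val : ↥(s : Set (Fin d → ℝ)) → (Fin d → ℝ))) :
    vertexDiffs (convexHull ℝ (s : Set (Fin d → ℝ))) = {w | ∃ u ∈ s, ∃ v ∈ s, w = u - v} := by
  simp [vertexDiffs, hs.extremePoints_convexHull]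

/-- The differences of a finite sequence generate the same subgroup as its increments. -/
theorem closure_differences {E : Type*} [AddCommGroup E] {m : ℕ} (v : Fin (m + 1) → E) :
    AddSubgroup.closure {w | ∃ s t, w = v s - v t} =
      AddSubgroup.closure (Set.range fun i : Fin m => v i.succ - v i.castSucc) := by
  apply le_antisymm <;> rw [AddSubgroup.closure_le]
  · have key (t : Fin (m + 1)) : v t - v 0 ∈
        AddSubgroup.closure (Set.range fun i : Fin m => v i.succ - v i.castSucc) := by
      induction t using Fin.induction with
      | zero => simp
      | succ i ih =>
        rw [← sub_add_sub_cancel (v i.succ) (v i.castSucc)]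
        exact add_mem (AddSubgroup.subset_closure ⟨i, rfl⟩) ih
    rintro _ ⟨s, t, rfl⟩
    rw [← sub_sub_sub_cancel_right (v s) (v t) (v 0)]
    exact sub_mem (key s) (key t)
  · rintro _ ⟨i, rfl⟩
    exact AddSubgroup.subset_closure ⟨_, _, rfl⟩

theorem span_addSubgroup_closure {E : Type*} [AddCommGroup E] [Module ℝ E] (s : Set E) :
    Submodule.span ℝ (AddSubgroup.closure s : Set E) = Submodule.span ℝ s := by
  apply le_antisymm
  · rw [Submodule.span_le]
    exact (AddSubgroup.closure_le (K := (Submodule.span ℝ s).toAddSubgroup)).2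
      Submodule.subset_span
  · exact Submodule.span_mono AddSubgroup.subset_closure

theorem polyIndex_congr {P Q : Set (Fin d → ℝ)} (h : latL P = latL Q) :
    polyIndex P = polyIndex Q := by
  have : latN P = latN Q := by
    unfold latN
    rw [← span_addSubgroup_closure (vertexDiffs P), ← span_addSubgroup_closure (vertexDiffs Q)]
    change (Submodule.span ℝ (latL P : Set (Fin d → ℝ))).toAddSubgroup ⊓ _ = _
    rw [h]
    rfl
  unfold polyIndex
  rw [this, h]

variable {E : Type*} [AddCommGroup E] [Module ℝ E]

theorem sum_initial_segment {m : ℕ} (v : Fin (m + 1) → E) (t : Fin (m + 1)) :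
    v 0 + ∑ i : Fin m, (if i.castSucc < t then (1 : ℝ) else 0) • (v i.succ - v i.castSucc) =
      v t := by
  induction t using Fin.induction with
  | zero => simp
  | succ j ih =>
    have h (i : Fin m) : (if i.castSucc < j.succ then (1 : ℝ) else 0) =
        (if i.castSucc < j.castSucc then (1 : ℝ) else 0) + if i = j then 1 else 0 := by
      simp only [Fin.lt_def, Fin.val_castSucc, Fin.val_succ, Fin.ext_iff]
      split_ifs <;> first | omega | simp
    simp only [h, add_smul, Finset.sum_add_distrib, ← add_assoc, ih]
    simp

end VertexLattice

section KuhnMap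

variable {d : ℕ} {I : Type*} [Fintype I]

/-- The affine map `y ↦ o + ∑ p, y p • b p`. -/
noncomputable def kuhnMap (o : Fin d → ℝ) (b : I → Fin d → ℝ) :
    (I → ℝ) →ᵃ[ℝ] (Fin d → ℝ) :=
  AffineMap.const ℝ (I → ℝ) o + (Fintype.linearCombination ℝ b).toAffineMap

theorem kuhnMap_apply (o : Fin d → ℝ) (b : I → Fin d → ℝ) (y : I → ℝ) :
    kuhnMap o b y = o + ∑ p, y p • b p := by
  simp [kuhnMap, Fintype.linearCombination_apply]

/-- The image of a lattice point under `kuhnMap`. -/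
noncomputable def kuhnVertex (o : Fin d → ℝ) (b : I → Fin d → ℝ) (z : I → ℤ) : Fin d → ℝ :=
  kuhnMap o b fun p => (z p : ℝ)

theorem kuhnVertex_apply (o : Fin d → ℝ) (b : I → Fin d → ℝ) (z : I → ℤ) :
    kuhnVertex o b z = o + ∑ p, (z p : ℝ) • b p :=
  kuhnMap_apply o b _

theorem kuhnVertex_injective (o : Fin d → ℝ) {b : I → Fin d → ℝ} (hb : LinearIndependent ℝ b) :
    Function.Injective (kuhnVertex o b) := by
  intro z w h
  rw [kuhnVertex_apply, kuhnVertex_apply, add_right_inj] at h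
  funext p
  exact_mod_cast Fintype.linearIndependent_iff.1 hb (fun p => (z p : ℝ) - w p)
    (by simp only [sub_smul, Finset.sum_sub_distrib, h, sub_self]) p |> sub_eq_zero.1

theorem isLatticePt_kuhnVertex {o : Fin d → ℝ} {b : I → Fin d → ℝ} (ho : IsLatticePt o)
    (hb : ∀ p, IsLatticePt (b p)) (z : I → ℤ) : IsLatticePt (kuhnVertex o b z) := by
  change kuhnVertex o b z ∈ intLattice d
  rw [kuhnVertex_apply]
  refine add_mem ho (sum_mem fun p _ => ?_)
  rw [Int.cast_smul_eq_zsmul]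
  exact zsmul_mem (hb p) _

theorem kuhnVertex_weights_unique (o : Fin d → ℝ) {b : I → Fin d → ℝ}
    (hb : LinearIndependent ℝ b) {ι : Type*} (U : Finset ι) (c : ι → I → ℤ)
    (hc : Set.InjOn c U) (l m : ι → ℝ) (hl : ∀ i ∈ U, 0 ≤ l i) (hm : ∀ i ∈ U, 0 ≤ m i)
    (hladj : ∀ i ∈ U, ∀ j ∈ U, 0 < l i → 0 < l j → KuhnAdj (c i) (c j))
    (hmadj : ∀ i ∈ U, ∀ j ∈ U, 0 < m i → 0 < m j → KuhnAdj (c i) (c j))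
    (hsum : ∑ i ∈ U, l i = ∑ i ∈ U, m i)
    (hmom : ∑ i ∈ U, l i • kuhnVertex o b (c i) = ∑ i ∈ U, m i • kuhnVertex o b (c i)) :
    ∀ i ∈ U, l i = m i := by
  refine kuhn_weights_unique U c hc l m hl hm hladj hmadj hsum fun p => ?_
  have expand (l : ι → ℝ) : ∑ i ∈ U, l i • kuhnVertex o b (c i) =
      (∑ i ∈ U, l i) • o + ∑ p, (∑ i ∈ U, l i * (c i p : ℝ)) • b p := by
    simp only [kuhnVertex_apply, smul_add, Finset.sum_add_distrib, Finset.sum_smul,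
      Finset.smul_sum, smul_smul]
    rw [Finset.sum_comm]
  rw [expand, expand, hsum, add_right_inj] at hmom
  exact Fintype.linearIndependent_iff.1 hb
    (fun p => ∑ i ∈ U, l i * (c i p : ℝ) - ∑ i ∈ U, m i * (c i p : ℝ))
    (by simp only [sub_smul, Finset.sum_sub_distrib, hmom, sub_self]) p |> sub_eq_zero.1

open Classical in
/-- The points of the simplex of the Kuhn triangulation given by `z` and `σ`. -/
noncomputable def kuhnCell (o : Fin d → ℝ) (b : I → Fin d → ℝ) {m : ℕ} (z : I → ℤ)
    (σ : Fin m ≃ I) : Finset (Fin d → ℝ) :=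
  Finset.univ.image fun t => kuhnVertex o b (kuhnChain z σ t)

theorem mem_kuhnCell {o : Fin d → ℝ} {b : I → Fin d → ℝ} {m : ℕ} {z : I → ℤ}
    {σ : Fin m ≃ I} {x : Fin d → ℝ} :
    x ∈ kuhnCell o b z σ ↔ ∃ t, kuhnVertex o b (kuhnChain z σ t) = x := by
  simp [kuhnCell]

theorem kuhnCell_nonempty (o : Fin d → ℝ) (b : I → Fin d → ℝ) {m : ℕ} (z : I → ℤ)
    (σ : Fin m ≃ I) : (kuhnCell o b z σ).Nonempty :=
  ⟨_, mem_kuhnCell.2 ⟨0, rfl⟩⟩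

/-- Lattice coordinates of the points of a Kuhn simplex. -/
theorem exists_coords_kuhnCell (o : Fin d → ℝ) {b : I → Fin d → ℝ}
    (hb : LinearIndependent ℝ b) :
    ∃ c : (Fin d → ℝ) → I → ℤ, ∀ (m : ℕ) (z : I → ℤ) (σ : Fin m ≃ I),
      (∀ x ∈ kuhnCell o b z σ, kuhnVertex o b (c x) = x) ∧
      ∀ x ∈ kuhnCell o b z σ, ∀ y ∈ kuhnCell o b z σ, KuhnAdj (c x) (c y) := by
  have hinv := Function.leftInverse_invFun (kuhnVertex_injective o hb)
  refine ⟨Function.invFun (kuhnVertex o b), fun m z σ => ⟨fun x hx => ?_, fun x hx y hy => ?_⟩⟩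
  · obtain ⟨t, rfl⟩ := mem_kuhnCell.1 hx
    rw [hinv]
  · obtain ⟨t, rfl⟩ := mem_kuhnCell.1 hx
    obtain ⟨s, rfl⟩ := mem_kuhnCell.1 hy
    rw [hinv, hinv]
    exact kuhnAdj_kuhnChain z σ t s

theorem affineIndependent_kuhnCell (o : Fin d → ℝ) {b : I → Fin d → ℝ}
    (hb : LinearIndependent ℝ b) {m : ℕ} (z : I → ℤ) (σ : Fin m ≃ I) :
    AffineIndependent ℝ
      (Subtype.val : ↥(kuhnCell o b z σ : Set (Fin d → ℝ)) → (Fin d → ℝ)) := by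
  obtain ⟨c, hc⟩ := exists_coords_kuhnCell o hb
  obtain ⟨hcv, hadj⟩ := hc m z σ
  rw [affineIndependent_iff]
  intro U w hw0 hw e he
  have hpm (r : ℝ) : max r 0 - max (-r) 0 = r := max_zero_sub_max_neg_zero_eq_self r
  have key := kuhnVertex_weights_unique o hb U (fun e => c e)
    (fun x _ y _ hxy => Subtype.ext <| by
      rw [← hcv x x.2, ← hcv y y.2]
      exact congrArg _ hxy)
    (fun e => max (w e) 0) (fun e => max (-w e) 0) (fun _ _ => le_max_right _ _)
    (fun _ _ => le_max_right _ _) (fun i _ j _ _ _ => hadj i i.2 j j.2)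
    (fun i _ j _ _ _ => hadj i i.2 j j.2)
    (by rw [← sub_eq_zero, ← Finset.sum_sub_distrib]; simpa only [hpm] using hw0)
    (by
      have h (e : ↥(kuhnCell o b z σ : Set (Fin d → ℝ))) : kuhnVertex o b (c e) = e :=
        hcv e e.2
      rw [← sub_eq_zero, ← Finset.sum_sub_distrib]
      simpa only [← sub_smul, hpm, h] using hw) e he
  rw [← hpm (w e)]
  exact sub_eq_zero.2 key

theorem convexHull_inter_subset_of_subset_kuhnCell (o : Fin d → ℝ) {b : I → Fin d → ℝ}
    (hb : LinearIndependent ℝ b) {m m' : ℕ} {z z' : I → ℤ} {σ : Fin m ≃ I} {σ' : Fin m' ≃ I}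
    {s t : Finset (Fin d → ℝ)} (hs : s ⊆ kuhnCell o b z σ) (ht : t ⊆ kuhnCell o b z' σ') :
    convexHull ℝ (s : Set (Fin d → ℝ)) ∩ convexHull ℝ (t : Set (Fin d → ℝ)) ⊆
      convexHull ℝ ((s : Set (Fin d → ℝ)) ∩ t) := by
  classical
  obtain ⟨c, hc⟩ := exists_coords_kuhnCell o hb
  obtain ⟨hcs, hadjs⟩ := hc m z σ
  obtain ⟨hct, hadjt⟩ := hc m' z' σ'
  rintro x ⟨hxs, hxt⟩
  obtain ⟨l, hl0, hl1, hlx⟩ := Finset.mem_convexHull'.1 hxs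
  obtain ⟨r, hr0, hr1, hrx⟩ := Finset.mem_convexHull'.1 hxt
  have hcU (y) (hy : y ∈ s ∪ t) : kuhnVertex o b (c y) = y := by
    rcases Finset.mem_union.1 hy with h | h
    · exact hcs y (hs h)
    · exact hct y (ht h)
  let l' : (Fin d → ℝ) → ℝ := fun y => if y ∈ s then l y else 0
  let r' : (Fin d → ℝ) → ℝ := fun y => if y ∈ t then r y else 0
  have hl's (y) (h : 0 < l' y) : y ∈ s := by
    by_contra hy
    simp [l', hy] at h
  have hr't (y) (h : 0 < r' y) : y ∈ t := by
    by_contra hy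
    simp [r', hy] at h
  have hl'1 : ∑ y ∈ s ∪ t, l' y = 1 := by
    simp only [l', Finset.sum_ite_mem, Finset.union_inter_cancel_left, hl1]
  have hr'1 : ∑ y ∈ s ∪ t, r' y = 1 := by
    simp only [r', Finset.sum_ite_mem, Finset.union_inter_cancel_right, hr1]
  have hl'x : ∑ y ∈ s ∪ t, l' y • y = x := by
    simp only [l', ite_smul, zero_smul, Finset.sum_ite_mem, Finset.union_inter_cancel_left, hlx]
  have hr'x : ∑ y ∈ s ∪ t, r' y • y = x := by
    simp only [r', ite_smul, zero_smul, Finset.sum_ite_mem, Finset.union_inter_cancel_right, hrx]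
  have key := kuhnVertex_weights_unique o hb (s ∪ t) c
    (fun x hx y hy hxy => by rw [← hcU x hx, ← hcU y hy, hxy]) l' r'
    (fun y _ => by
      simp only [l']
      split_ifs with h
      exacts [hl0 y h, le_rfl])
    (fun y _ => by
      simp only [r']
      split_ifs with h
      exacts [hr0 y h, le_rfl])
    (fun i _ j _ hi hj => hadjs i (hs (hl's i hi)) j (hs (hl's j hj)))
    (fun i _ j _ hi hj => hadjt i (ht (hr't i hi)) j (ht (hr't j hj)))
    (hl'1.trans hr'1.symm)
    (by
      have hval (f : (Fin d → ℝ) → ℝ) : ∑ y ∈ s ∪ t, f y • kuhnVertex o b (c y) =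
          ∑ y ∈ s ∪ t, f y • y := Finset.sum_congr rfl fun y hy => by rw [hcU y hy]
      rw [hval, hval, hl'x, hr'x])
  have hout (y) (hy : y ∈ s) (hy' : y ∉ s ∩ t) : l y = 0 := by
    have := key y (Finset.mem_union_left _ hy)
    have hyt : y ∉ t := fun h => hy' (Finset.mem_inter.2 ⟨hy, h⟩)
    simpa [l', r', hy, hyt] using this
  rw [← Finset.coe_inter, Finset.mem_convexHull']
  refine ⟨l, fun y hy => hl0 y (Finset.mem_inter.1 hy).1, ?_, ?_⟩
  · rw [← hl1]
    exact Finset.sum_subset Finset.inter_subset_left hout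
  · rw [← hlx]
    refine Finset.sum_subset Finset.inter_subset_left fun y hy hy' => ?_
    rw [hout y hy hy', zero_smul]

theorem latL_convexHull_kuhnCell (o : Fin d → ℝ) {b : I → Fin d → ℝ}
    (hb : LinearIndependent ℝ b) {m : ℕ} (z : I → ℤ) (σ : Fin m ≃ I) :
    latL (convexHull ℝ (kuhnCell o b z σ : Set (Fin d → ℝ))) =
      AddSubgroup.closure (Set.range b) := by
  classical
  rw [latL, vertexDiffs_convexHull (affineIndependent_kuhnCell o hb z σ)]
  have h1 : {w | ∃ u ∈ kuhnCell o b z σ, ∃ v ∈ kuhnCell o b z σ, w = u - v} =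
      {w | ∃ s t, w = kuhnVertex o b (kuhnChain z σ s) - kuhnVertex o b (kuhnChain z σ t)} := by
    ext w
    simp [mem_kuhnCell]
  rw [h1, closure_differences fun t => kuhnVertex o b (kuhnChain z σ t)]
  have h2 (i : Fin m) : kuhnVertex o b (kuhnChain z σ i.succ) -
      kuhnVertex o b (kuhnChain z σ i.castSucc) = b (σ i) := by
    rw [kuhnVertex_apply, kuhnVertex_apply, add_sub_add_left_eq_sub, ← Finset.sum_sub_distrib,
      Finset.sum_eq_single (σ i)]
    · rw [← sub_smul]
      simp [kuhnChain]
    · intro p _ hp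
      have hne : σ.symm p ≠ i := fun h => hp (by simp [← h])
      have : ((σ.symm p).castSucc < i.succ) ↔ ((σ.symm p).castSucc < i.castSucc) := by
        simp only [Fin.lt_def, Fin.val_castSucc, Fin.val_succ]
        have : (σ.symm p : ℕ) ≠ i := fun h => hne (Fin.ext h)
        omega
      simp [kuhnChain, this]
    · simp
  simp only [h2]
  congr 1
  exact σ.surjective.range_comp b

/-- A convex region tiled by simplices of the Kuhn triangulation has a triangulation whose maximal
simplices all have the lattice generated by `b`. -/
theorem exists_triangulation_image_kuhnMap {o : Fin d → ℝ} {b : I → Fin d → ℝ}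
    (ho : IsLatticePt o) (hbl : ∀ p, IsLatticePt (b p)) (hb : LinearIndependent ℝ b) {m : ℕ}
    {R : Set (I → ℝ)} (hR : Convex ℝ R) {A B : I → ℤ}
    (hbdd : ∀ z : I → ℤ, (fun p => (z p : ℝ)) ∈ R → z ∈ Set.Icc A B)
    (hcover : ∀ x ∈ R, ∃ (z : I → ℤ) (σ : Fin m ≃ I),
      (∀ t, (fun p => (kuhnChain z σ t p : ℝ)) ∈ R) ∧
      x ∈ convexHull ℝ (Set.range fun t p => (kuhnChain z σ t p : ℝ))) :
    ∃ T : Set (Set (Fin d → ℝ)), IsTriangulation T (kuhnMap o b '' R) ∧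
      (∀ S' ∈ T, IsIntegralSimplex S') ∧
      ∀ S' ∈ T, (∀ S'' ∈ T, S' ⊆ S'' → S'' = S') →
        latL S' = AddSubgroup.closure (Set.range b) := by
  classical
  let Adm (z : I → ℤ) (σ : Fin m ≃ I) : Prop := ∀ t, (fun p => (kuhnChain z σ t p : ℝ)) ∈ R
  let K : Geometry.SimplicialComplex ℝ (Fin d → ℝ) :=
    { faces := {s | s.Nonempty ∧ ∃ z σ, Adm z σ ∧ s ⊆ kuhnCell o b z σ}
      isRelLowerSet_faces := by
        rintro s ⟨hs, z, σ, had, hsub⟩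
        exact ⟨hs, fun t hts ht => ⟨ht, z, σ, had, hts.trans hsub⟩⟩
      indep := by
        rintro s ⟨hs, z, σ, had, hsub⟩
        exact (affineIndependent_kuhnCell o hb z σ).mono (Finset.coe_subset.2 hsub)
      inter_subset_convexHull := by
        rintro s t ⟨-, z, σ, -, hs⟩ ⟨-, z', σ', -, ht⟩
        exact convexHull_inter_subset_of_subset_kuhnCell o hb hs ht }
  have hfin : K.faces.Finite := by
    refine Set.Finite.subset (s := ⋃ z ∈ Set.Icc A B, ⋃ σ : Fin m ≃ I,
      ((kuhnCell o b z σ).powerset : Set (Finset (Fin d → ℝ)))) ?_ ?_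
    · exact (Set.finite_Icc A B).biUnion fun z _ => Set.finite_iUnion fun σ =>
        Finset.finite_toSet _
    · rintro s ⟨-, z, σ, had, hs⟩
      have hz : z ∈ Set.Icc A B := hbdd z (by simpa [kuhnChain] using had 0)
      simp only [Set.mem_iUnion]
      exact ⟨z, hz, σ, Finset.mem_coe.2 (Finset.mem_powerset.2 hs)⟩
  have hcell {z σ} (had : Adm z σ) : kuhnCell o b z σ ∈ K.faces :=
    ⟨kuhnCell_nonempty _ _ _ _, z, σ, had, subset_rfl⟩
  have hspace : K.space = kuhnMap o b '' R := by
    apply Set.Subset.antisymm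
    · intro x hx
      obtain ⟨s, ⟨-, z, σ, had, hs⟩, hxs⟩ := Geometry.SimplicialComplex.mem_space_iff.1 hx
      refine convexHull_min (fun y hy => ?_) (hR.affine_image _) hxs
      obtain ⟨t, rfl⟩ := mem_kuhnCell.1 (hs hy)
      exact ⟨_, had t, rfl⟩
    · rintro _ ⟨x, hx, rfl⟩
      obtain ⟨z, σ, had, hxc⟩ := hcover x hx
      refine Geometry.SimplicialComplex.mem_space_iff.2 ⟨_, hcell had, ?_⟩
      have := Set.mem_image_of_mem (kuhnMap o b) hxc
      rw [AffineMap.image_convexHull, ← Set.range_comp] at this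
      convert this using 2
      simp [kuhnCell]
      rfl
  refine ⟨_, hspace ▸ K.isTriangulation hfin, ?_, ?_⟩
  · rintro _ ⟨s, hs, rfl⟩
    refine ⟨s, hs.1, fun u hu => ?_, K.indep hs, rfl⟩
    obtain ⟨-, z, σ, -, hsub⟩ := hs
    obtain ⟨t, rfl⟩ := mem_kuhnCell.1 (hsub hu)
    exact isLatticePt_kuhnVertex ho hbl _
  · rintro _ ⟨s, ⟨-, z, σ, had, hsub⟩, rfl⟩ hmax
    rw [← hmax _ ⟨_, hcell had, rfl⟩ (convexHull_mono (Finset.coe_subset.2 hsub))]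
    exact latL_convexHull_kuhnCell o hb z σ

end KuhnMap

section Region

/-- The product of the dilated ordered simplices `a j ≥ x₁ ≥ ⋯ ≥ x_{k j} ≥ 0`. -/
def orderedRegion {n : ℕ} (k : Fin n → ℕ) (a : Fin n → ℕ) : Set ((Σ j, Fin (k j)) → ℝ) :=
  {x | ∀ j, Antitone (fun i => x ⟨j, i⟩) ∧ ∀ i, x ⟨j, i⟩ ∈ Set.Icc (0 : ℝ) (a j)}

variable {n : ℕ} {k : Fin n → ℕ} {a : Fin n → ℕ}

theorem convex_orderedRegion : Convex ℝ (orderedRegion k a) := by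
  intro x hx y hy α β hα hβ hαβ j
  refine ⟨fun i i' hi => ?_, fun i => ?_⟩
  · exact add_le_add (mul_le_mul_of_nonneg_left ((hx j).1 hi) hα)
      (mul_le_mul_of_nonneg_left ((hy j).1 hi) hβ)
  · exact convex_Icc (0 : ℝ) (a j) ((hx j).2 i) ((hy j).2 i) hα hβ hαβ

theorem mem_Icc_of_mem_orderedRegion {z : (Σ j, Fin (k j)) → ℤ}
    (hz : (fun p => (z p : ℝ)) ∈ orderedRegion k a) :
    z ∈ Set.Icc (fun _ => 0) (fun p => (a p.1 : ℤ)) :=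
  ⟨fun p => Int.cast_nonneg_iff.1 ((hz p.1).2 p.2).1,
    fun p => (Int.cast_le (R := ℝ)).1 (by simpa using ((hz p.1).2 p.2).2)⟩

/-- Every point of the region lies in a simplex of the Kuhn triangulation contained in it. -/
theorem exists_kuhnChain_orderedRegion (ha : ∀ j, 0 < a j) {x : (Σ j, Fin (k j)) → ℝ}
    (hx : x ∈ orderedRegion k a) :
    ∃ (z : (Σ j, Fin (k j)) → ℤ) (σ : Fin (Fintype.card (Σ j, Fin (k j))) ≃ Σ j, Fin (k j)),
      (∀ t, (fun p => (kuhnChain z σ t p : ℝ)) ∈ orderedRegion k a) ∧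
      x ∈ convexHull ℝ (Set.range fun t p => (kuhnChain z σ t p : ℝ)) := by
  let z : (Σ j, Fin (k j)) → ℤ := fun p => min ⌊x p⌋ (a p.1 - 1)
  let f : (Σ j, Fin (k j)) → ℝ := fun p => x p - z p
  have hx0 (p) : 0 ≤ x p := ((hx p.1).2 p.2).1
  have hxa (p) : x p ≤ a p.1 := ((hx p.1).2 p.2).2
  have hxz (p) : x p = z p + f p := by simp [f]
  have hz0 (p) : 0 ≤ z p := le_min (Int.floor_nonneg.2 (hx0 p)) (by have := ha p.1; omega)
  have hza (p) : z p + 1 ≤ a p.1 := by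
    have : z p ≤ a p.1 - 1 := min_le_right _ _
    omega
  have hf0 (p) : 0 ≤ f p := by
    have h1 : (z p : ℝ) ≤ ⌊x p⌋ := by exact_mod_cast min_le_left _ _
    have := Int.floor_le (x p)
    simp only [f]
    linarith
  have hf1 (p) : f p ≤ 1 := by
    simp only [f]
    rcases min_choice ⌊x p⌋ ((a p.1 : ℤ) - 1) with h | h
    · have : z p = ⌊x p⌋ := h
      rw [this]
      linarith [Int.lt_floor_add_one (x p)]
    · have : z p = a p.1 - 1 := h
      rw [this]
      push_cast
      linarith [hxa p]
  let N := Fintype.card (Σ j, Fin (k j))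
  let e : Fin N ≃ Σ j, Fin (k j) := (Fintype.equivFin _).symm
  let key : (Σ j, Fin (k j)) → ℝ ×ₗ ℕ := fun p => toLex (-f p, (p.2 : ℕ))
  let σ : Fin N ≃ Σ j, Fin (k j) := (Tuple.sort (key ∘ e)).trans e
  have hσ : Monotone (key ∘ σ) := Tuple.monotone_sort (key ∘ e)
  have hanti : Antitone (f ∘ σ) := by
    intro s t hst
    have := Prod.Lex.monotone_fst _ _ (hσ hst)
    exact neg_le_neg_iff.1 this
  have hzmono (j) {i i' : Fin (k j)} (hi : i ≤ i') : z ⟨j, i'⟩ ≤ z ⟨j, i⟩ :=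
    min_le_min_right _ (Int.floor_le_floor ((hx j).1 hi))
  refine ⟨z, σ, fun t j => ⟨fun i i' hi => ?_, fun i => ?_⟩, ?_⟩
  · simp only [Int.cast_le]
    rcases hi.eq_or_lt with rfl | hlt
    · exact le_rfl
    rcases (hzmono j hi).eq_or_lt with h | h
    · have hf : f ⟨j, i'⟩ ≤ f ⟨j, i⟩ := by
        have := (hx j).1 hi
        simp only [f, h]
        simpa using this
      have hkey : key ⟨j, i⟩ < key ⟨j, i'⟩ := by
        rw [Prod.Lex.toLex_lt_toLex]
        rcases hf.eq_or_lt with hf | hf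
        · exact Or.inr ⟨by simp [hf], hlt⟩
        · exact Or.inl (neg_lt_neg hf)
      have hord : σ.symm ⟨j, i⟩ < σ.symm ⟨j, i'⟩ := by
        by_contra! hle
        have := hσ hle
        simp only [Function.comp_apply, Equiv.apply_symm_apply] at this
        exact absurd hkey this.not_gt
      simp only [kuhnChain, h, add_le_add_iff_left]
      split_ifs with h1 h2
      · rfl
      · exact absurd ((Fin.castSucc_lt_castSucc_iff.2 hord).trans h1) h2
      · simp
      · rfl
    · simp only [kuhnChain]
      split_ifs <;> omega
  · have h1 := hz0 ⟨j, i⟩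
    have h2 : z ⟨j, i⟩ + 1 ≤ a j := hza ⟨j, i⟩
    have h3 : 0 ≤ kuhnChain z σ t ⟨j, i⟩ ∧ kuhnChain z σ t ⟨j, i⟩ ≤ a j := by
      simp only [kuhnChain]
      constructor <;> split_ifs <;> omega
    exact ⟨Int.cast_nonneg_iff.2 h3.1, by simpa using (Int.cast_le (R := ℝ)).2 h3.2⟩
  · have hmem := mem_convexHull_initial_segments (f ∘ σ) hanti (fun _ => hf0 _) (fun _ => hf1 _)
    let g : (Fin N → ℝ) →ᵃ[ℝ] ((Σ j, Fin (k j)) → ℝ) :=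
      AffineMap.const ℝ _ (fun p => (z p : ℝ)) +
        (LinearMap.funLeft ℝ ℝ σ.symm).toAffineMap
    have hg (y) : g y = fun p => (z p : ℝ) + y (σ.symm p) := by
      ext p; simp [g, LinearMap.funLeft_apply]
    have := Set.mem_image_of_mem g hmem
    rw [AffineMap.image_convexHull, ← Set.range_comp] at this
    have hgx : g (f ∘ σ) = x := by
      funext p
      simp [hg, hxz p]
    have hgc : (g ∘ fun (t : Fin (N + 1)) (i : Fin N) => if i.castSucc < t then (1 : ℝ) else 0) =
        fun t p => (kuhnChain z σ t p : ℝ) := by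
      funext t p
      simp [hg, kuhnChain]
    rwa [hgx, hgc] at this

theorem convexHull_range_eq_image {d m : ℕ} (v : Fin (m + 1) → Fin d → ℝ) :
    convexHull ℝ (Set.range v) = kuhnMap (v 0) (fun i : Fin m => v i.succ - v i.castSucc) ''
      {g | Antitone g ∧ ∀ i, g i ∈ Set.Icc (0 : ℝ) 1} := by
  have hv (t : Fin (m + 1)) : kuhnMap (v 0) (fun i : Fin m => v i.succ - v i.castSucc)
      (fun i => if i.castSucc < t then (1 : ℝ) else 0) = v t := by
    rw [kuhnMap_apply, sum_initial_segment]
  apply Set.Subset.antisymm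
  · refine convexHull_min ?_ (Convex.affine_image _ ?_)
    · rintro _ ⟨t, rfl⟩
      refine ⟨_, ⟨fun i j hij => ?_, fun i => ?_⟩, hv t⟩
      · split_ifs with h1 h2
        · rfl
        · exact absurd ((Fin.castSucc_le_castSucc_iff.2 hij).trans_lt h1) h2
        · simp
        · rfl
      · split_ifs <;> simp
    · intro x hx y hy α β hα hβ hαβ
      refine ⟨fun i i' hi => ?_, fun i => ?_⟩
      · exact add_le_add (mul_le_mul_of_nonneg_left (hx.1 hi) hα)
          (mul_le_mul_of_nonneg_left (hy.1 hi) hβ)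
      · exact convex_Icc (0 : ℝ) 1 (hx.2 i) (hy.2 i) hα hβ hαβ
  · rintro _ ⟨g, ⟨hg, hg01⟩, rfl⟩
    have := Set.mem_image_of_mem (kuhnMap (v 0) (fun i : Fin m => v i.succ - v i.castSucc))
      (mem_convexHull_initial_segments g hg (fun i => (hg01 i).1) (fun i => (hg01 i).2))
    rw [AffineMap.image_convexHull, ← Set.range_comp] at this
    convert this using 3
    funext t
    exact (hv t).symm

/-- A Minkowski sum of dilated simplices is the image of the ordered region. -/
theorem sum_smul_convexHull_range {d : ℕ} (ha : ∀ j, 0 < a j)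
    (v : ∀ j, Fin (k j + 1) → Fin d → ℝ) :
    ∑ j, (a j : ℝ) • convexHull ℝ (Set.range (v j)) =
      kuhnMap (∑ j, (a j : ℝ) • v j 0)
        (fun p : Σ j, Fin (k j) => v p.1 p.2.succ - v p.1 p.2.castSucc) '' orderedRegion k a := by
  have ha' (j) : (0 : ℝ) < a j := by exact_mod_cast ha j
  have hsum (x : (Σ j, Fin (k j)) → ℝ) : kuhnMap (∑ j, (a j : ℝ) • v j 0)
      (fun p : Σ j, Fin (k j) => v p.1 p.2.succ - v p.1 p.2.castSucc) x =
        ∑ j, (a j : ℝ) • kuhnMap (v j 0) (fun i => v j i.succ - v j i.castSucc)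
          (fun i => x ⟨j, i⟩ / a j) := by
    simp only [kuhnMap_apply, smul_add, Finset.sum_add_distrib, Finset.smul_sum, smul_smul,
      Fintype.sum_sigma, mul_div_cancel₀ _ (ha' _).ne']
  ext w
  simp only [convexHull_range_eq_image, Set.mem_fintype_sum]
  constructor
  · rintro ⟨g, hg, rfl⟩
    choose u hu hug using hg
    choose y hy hyu using hu
    refine ⟨fun p => a p.1 * y p.1 p.2, fun j => ⟨fun i i' hi => ?_, fun i => ⟨?_, ?_⟩⟩, ?_⟩
    · exact mul_le_mul_of_nonneg_left ((hy j).1 hi) (ha' j).le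
    · exact mul_nonneg (ha' j).le ((hy j).2 i).1
    · exact mul_le_of_le_one_right (ha' j).le ((hy j).2 i).2
    · rw [hsum]
      refine Finset.sum_congr rfl fun j _ => ?_
      simp only [mul_div_cancel_left₀ _ (ha' j).ne']
      rw [hyu]
      exact hug j
  · rintro ⟨x, hx, rfl⟩
    refine ⟨_, fun j => Set.smul_mem_smul_set ⟨fun i => x ⟨j, i⟩ / a j, ⟨fun i i' hi => ?_,
      fun i => ⟨?_, ?_⟩⟩, rfl⟩, (hsum x).symm⟩
    · exact div_le_div_of_nonneg_right ((hx j).1 hi) (ha' j).le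
    · exact div_nonneg ((hx j).2 i).1 (ha' j).le
    · exact div_le_one_of_le₀ ((hx j).2 i).2 (ha' j).le

end Region

section MinkowskiSum

variable {d n : ℕ}

theorem exists_triangulation_sum_smul (V : Fin n → Finset (Fin d → ℝ))
    (hne : ∀ j, (V j).Nonempty) (hint : ∀ j, ∀ u ∈ V j, IsLatticePt u)
    (haff : ∀ j, AffineIndependent ℝ
      (Subtype.val : ↥(V j : Set (Fin d → ℝ)) → (Fin d → ℝ)))
    (hindep : Module.finrank ℝ
        ↥(⨆ j, Submodule.span ℝ (vertexDiffs (convexHull ℝ (V j : Set (Fin d → ℝ))))) =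
      ∑ j, Module.finrank ℝ
        ↥(Submodule.span ℝ (vertexDiffs (convexHull ℝ (V j : Set (Fin d → ℝ))))))
    (a : Fin n → ℕ) (ha : ∀ j, 0 < a j) :
    ∃ T : Set (Set (Fin d → ℝ)),
      IsTriangulation T (∑ j, (a j : ℝ) • convexHull ℝ (V j : Set (Fin d → ℝ))) ∧
      (∀ S' ∈ T, IsIntegralSimplex S') ∧
      ∀ S' ∈ T, (∀ S'' ∈ T, S' ⊆ S'' → S'' = S') →
        latL S' = ⨆ j, latL (convexHull ℝ (V j : Set (Fin d → ℝ))) := by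
  let k (j : Fin n) : ℕ := (V j).card - 1
  have hk (j) : (V j).card = k j + 1 := (Nat.sub_add_cancel (hne j).card_pos).symm
  let e (j : Fin n) : Fin (k j + 1) ≃ ↥(V j : Set (Fin d → ℝ)) :=
    ((V j).equivFinOfCardEq (hk j)).symm
  let v (j : Fin n) (i : Fin (k j + 1)) : Fin d → ℝ := (e j i).1
  have hvrange (j) : Set.range (v j) = V j := by
    have : v j = Subtype.val ∘ e j := rfl
    rw [this, (e j).surjective.range_comp, Subtype.range_coe]
  have hvmem (j i) : v j i ∈ V j := (e j i).2
  let b (p : Σ j, Fin (k j)) : Fin d → ℝ := v p.1 p.2.succ - v p.1 p.2.castSucc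
  let inc (j : Fin n) (i : Fin (k j)) : Fin d → ℝ := v j i.succ - v j i.castSucc
  have hdiffs (j) : vertexDiffs (convexHull ℝ (V j : Set (Fin d → ℝ))) =
      {w | ∃ s t, w = v j s - v j t} := by
    rw [vertexDiffs_convexHull (haff j)]
    ext w
    simp only [← Finset.mem_coe, ← hvrange j, Set.exists_range_iff]
  have hlat (j) : latL (convexHull ℝ (V j : Set (Fin d → ℝ))) =
      AddSubgroup.closure (Set.range (inc j)) := by
    rw [latL, hdiffs]
    exact closure_differences (v j)
  have hspan (j) : Submodule.span ℝ (vertexDiffs (convexHull ℝ (V j : Set (Fin d → ℝ)))) =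
      Submodule.span ℝ (Set.range (inc j)) := by
    rw [← span_addSubgroup_closure, ← span_addSubgroup_closure (Set.range (inc j)), ← hlat]
    rfl
  have hrange : Set.range b = ⋃ j, Set.range (inc j) := by
    ext w
    simp only [Set.mem_range, Sigma.exists, Set.mem_iUnion]
    rfl
  have hfin (j) : Module.finrank ℝ
      ↥(Submodule.span ℝ (vertexDiffs (convexHull ℝ (V j : Set (Fin d → ℝ))))) = k j := by
    have hv : AffineIndependent ℝ (v j) := (haff j).comp_embedding (e j).toEmbedding
    have hset : {w | ∃ s t, w = v j s - v j t} = Set.range (v j) -ᵥ Set.range (v j) := by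
      ext w
      simp [Set.mem_vsub, eq_comm]
    rw [← hv.finrank_vectorSpan (Fintype.card_fin _), hdiffs, vectorSpan, hset]
  have hb : LinearIndependent ℝ b := by
    rw [linearIndependent_iff_card_eq_finrank_span, Set.finrank, hrange, Submodule.span_iUnion,
      ← iSup_congr hspan, hindep]
    simp only [hfin, Fintype.card_sigma, Fintype.card_fin]
  have hbl (p) : IsLatticePt (b p) :=
    (intLattice d).sub_mem (hint _ _ (hvmem _ _)) (hint _ _ (hvmem _ _))
  have ho : IsLatticePt (∑ j, (a j : ℝ) • v j 0) := by
    change _ ∈ intLattice d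
    refine sum_mem fun j _ => ?_
    rw [Nat.cast_smul_eq_nsmul]
    exact nsmul_mem (hint _ _ (hvmem _ _)) _
  obtain ⟨T, hT, hTint, hTmax⟩ := exists_triangulation_image_kuhnMap ho hbl hb
    (convex_orderedRegion (k := k) (a := a)) (fun z => mem_Icc_of_mem_orderedRegion)
    (fun x => exists_kuhnChain_orderedRegion ha)
  refine ⟨T, ?_, hTint, fun S' hS' hmax => ?_⟩
  · simp only [← hvrange, sum_smul_convexHull_range ha v]
    exact hT
  · rw [hTmax S' hS' hmax, hrange, AddSubgroup.closure_iUnion]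
    simp only [hlat]

end MinkowskiSum

theorem statement18 (d n : ℕ) (hd : 0 < d)
    (V : Fin n → Finset (Fin d → ℝ))
    (hne : ∀ j, (V j).Nonempty)
    (hint : ∀ j, ∀ u ∈ V j, IsLatticePt u)
    (haff : ∀ j, AffineIndependent ℝ (Subtype.val : ↥((V j : Set (Fin d → ℝ))) → (Fin d → ℝ)))
    (S : Fin n → Set (Fin d → ℝ)) (hS : ∀ j, S j = convexHull ℝ ((V j : Set (Fin d → ℝ))))
    -- the simplices are independent
    (hindep : Module.finrank ℝ ↥(⨆ j, Submodule.span ℝ (vertexDiffs (S j))) =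
      ∑ j, Module.finrank ℝ ↥(Submodule.span ℝ (vertexDiffs (S j))))
    (a : Fin n → ℕ) (ha : ∀ j, 0 < a j) :
    -- the Minkowski sum `∑ j, a j • S j` has a triangulation into integral simplices whose
    -- maximal cells `S'` satisfy `L(S') = L(S₁) + ⋯ + L(Sₙ)`
    (∃ T : Set (Set (Fin d → ℝ)),
      IsTriangulation T (∑ j, (a j : ℝ) • S j) ∧
      (∀ S' ∈ T, IsIntegralSimplex S') ∧
      (∀ S' ∈ T, (∀ S'' ∈ T, S' ⊆ S'' → S'' = S') → latL S' = ⨆ j, latL (S j))) ∧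
    -- in particular, for every integral simplex `T₀` and positive integer `c`, `c•T₀` has a
    -- triangulation into integral simplices whose maximal cells have `L(S') = L(T₀)`, hence
    -- the same index as `T₀`
    (∀ W : Finset (Fin d → ℝ), W.Nonempty → (∀ u ∈ W, IsLatticePt u) →
      AffineIndependent ℝ (Subtype.val : ↥(W : Set (Fin d → ℝ)) → (Fin d → ℝ)) →
      ∀ c : ℕ, 0 < c →
        ∃ T : Set (Set (Fin d → ℝ)),
          IsTriangulation T ((c : ℝ) • convexHull ℝ (W : Set (Fin d → ℝ))) ∧
          (∀ S' ∈ T, IsIntegralSimplex S') ∧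
          (∀ S' ∈ T, (∀ S'' ∈ T, S' ⊆ S'' → S'' = S') →
            latL S' = latL (convexHull ℝ (W : Set (Fin d → ℝ))) ∧
            polyIndex S' = polyIndex (convexHull ℝ (W : Set (Fin d → ℝ))))) := by
  obtain rfl : S = fun j => convexHull ℝ (V j : Set (Fin d → ℝ)) := funext hS
  refine ⟨exists_triangulation_sum_smul V hne hint haff hindep a ha, ?_⟩
  intro W hW hWint hWaff c hc
  obtain ⟨T, hT, hTint, hTmax⟩ := exists_triangulation_sum_smul (fun _ : Fin 1 => W)
    (fun _ => hW) (fun _ => hWint) (fun _ => hWaff) (by rw [iSup_const]; simp) (fun _ => c) (fun _ => hc)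
  refine ⟨T, by simpa using hT, hTint, fun S' hS' hmax => ?_⟩
  have hlat : latL S' = latL (convexHull ℝ (W : Set (Fin d → ℝ))) := by
    simpa using hTmax S' hS' hmax
  exact ⟨hlat, polyIndex_congr hlat⟩
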